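/- arXiv:1506.05715 — 2 statements merged into one kernel-verified Lean document; each statement's English description precedes it below -/
import Mathlib

section
/- Let S ⊆ (ZMod 2)⁴ be the P-node 4-constraint, i.e. the six tuples (0,1,0,0), (0,0,1,0), (0,0,0,1) together with their bitwise complements (1,0,1,1), (1,1,0,1), (1,1,1,0). Then for every pair of distinct coordinates i ≠ j in Fin 4 and every constant c ∈ ZMod 2, the restricted set {x ∈ S | x i + x j = c} is nonempty and equals the carrier of an affine subspace of the ZMod 2-module Fin 4 → ZMod 2. (In particular, once two of the four variables are constrained to be equal or unequal, the P-node 4-constraint becomes equivalent to a set of equations and inequalities between pairs of Boolean variables.) -/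
/-- The P-node 4-constraint: the six feasible tuples of the ordering variable `ord(μ)`
and the three relative-position variables of a virtual edge of a P-node. -/
def PNodeConstraint : Set (Fin 4 → ZMod 2) :=
  {![0,1,0,0], ![0,0,1,0], ![0,0,0,1], ![1,0,1,1], ![1,1,0,1], ![1,1,1,0]}

/-- The P-node 4-constraint as a finset, for decidability of bounded quantifiers. -/
def pNodeFinset : Finset (Fin 4 → ZMod 2) :=
  {![0,1,0,0], ![0,0,1,0], ![0,0,0,1], ![1,0,1,1], ![1,1,0,1], ![1,1,1,0]}

theorem coe_pNodeFinset : (pNodeFinset : Set (Fin 4 → ZMod 2)) = PNodeConstraint := by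
  simp [pNodeFinset, PNodeConstraint]

theorem add_add_mem_pNodeConstraint {i j : Fin 4} (hij : i ≠ j) {x y z : Fin 4 → ZMod 2}
    (hx : x ∈ PNodeConstraint) (hy : y ∈ PNodeConstraint) (hz : z ∈ PNodeConstraint)
    (hxy : x i + x j = y i + y j) (hyz : y i + y j = z i + z j) :
    x + y + z ∈ PNodeConstraint := by
  have key : ∀ x ∈ pNodeFinset, ∀ y ∈ pNodeFinset, ∀ z ∈ pNodeFinset, ∀ i j : Fin 4, i ≠ j →
      x i + x j = y i + y j → y i + y j = z i + z j → x + y + z ∈ pNodeFinset := by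
    decide +kernel
  rw [← coe_pNodeFinset, Finset.mem_coe] at *
  exact key x hx y hy z hz i j hij hxy hyz

theorem exists_mem_pNodeConstraint_add_eq {i j : Fin 4} (hij : i ≠ j) (c : ZMod 2) :
    ∃ x ∈ PNodeConstraint, x i + x j = c := by
  have key : ∀ i j : Fin 4, i ≠ j → ∀ c : ZMod 2, ∃ x ∈ pNodeFinset, x i + x j = c := by
    decide +kernel
  simpa only [← coe_pNodeFinset, Finset.mem_coe] using key i j hij c

theorem pnode_constraint_restricted_is_affine :
    ∀ i j : Fin 4, i ≠ j → ∀ c : ZMod 2,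
      {x ∈ PNodeConstraint | x i + x j = c}.Nonempty ∧
      ∃ A : AffineSubspace (ZMod 2) (Fin 4 → ZMod 2),
        (A : Set (Fin 4 → ZMod 2)) = {x ∈ PNodeConstraint | x i + x j = c} := by
  intro i j hij c
  refine ⟨exists_mem_pNodeConstraint_add_eq hij c,
    { carrier := {x ∈ PNodeConstraint | x i + x j = c}
      smul_vsub_vadd_mem' := ?_ }, rfl⟩
  rintro a x y z ⟨hx, hxc⟩ ⟨hy, hyc⟩ ⟨hz, hzc⟩
  obtain rfl | rfl : a = 0 ∨ a = 1 := by revert a; decide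
  · simpa using ⟨hz, hzc⟩
  · have hsum : (1 : ZMod 2) • (x -ᵥ y) +ᵥ z = x + y + z := by
      simp [CharTwo.sub_eq_add]
    rw [hsum]
    refine ⟨add_add_mem_pNodeConstraint hij hx hy hz (hxc.trans hyc.symm)
      (hyc.trans hzc.symm), ?_⟩
    calc (x + y + z) i + (x + y + z) j = (x i + x j) + (y i + y j) + (z i + z j) := by
          simp only [Pi.add_apply]; ring
      _ = c := by rw [hxc, hyc, hzc, CharTwo.add_self_eq_zero, zero_add]
end

section
/- Let G be a simple graph on a vertex set V, let u and v be distinct vertices, and let G' denote the subgraph of G induced on the set of vertices different from v. Suppose that v is dominated by u, i.e., every neighbor w of v in G is connected to u by a path in G that does not contain v (equivalently, w is reachable from u in G'). Then removing v does not change the connected components among the remaining vertices: for all vertices a and b different from v, a and b are reachable from each other in G if and only if they are reachable from each other in G'. -/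
/-- A map sending adjacent vertices to mutually reachable ones preserves reachability. -/
theorem SimpleGraph.Reachable.of_forall_adj {V W : Type*} {G : SimpleGraph V} {H : SimpleGraph W}
    (f : V → W) (hf : ∀ x y, G.Adj x y → H.Reachable (f x) (f y)) {a b : V}
    (h : G.Reachable a b) : H.Reachable (f a) (f b) := by
  obtain ⟨p⟩ := h
  induction p with
  | nil => exact .refl _
  | cons hadj _ ih => exact (hf _ _ hadj).trans ih

theorem removing_dominated_vertex_preserves_reachability
    {V : Type*} (G : SimpleGraph V) (u v : V) (huv : u ≠ v)
    (hdom : ∀ w, (h : G.Adj v w) →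
      (G.induce {x | x ≠ v}).Reachable ⟨u, huv⟩ ⟨w, (G.ne_of_adj h).symm⟩) :
    ∀ (a b : V) (ha : a ≠ v) (hb : b ≠ v),
      G.Reachable a b ↔ (G.induce {x | x ≠ v}).Reachable ⟨a, ha⟩ ⟨b, hb⟩ := by
  classical
  intro a b ha hb
  refine ⟨fun h ↦ ?_, fun h ↦ h.map (SimpleGraph.Embedding.induce _).toHom⟩
  -- Retract `V` onto the complement of `v` by sending `v` to `u`.
  let r : V → {x | x ≠ v} := fun x ↦ if hx : x = v then ⟨u, huv⟩ else ⟨x, hx⟩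
  have hr_self : r v = ⟨u, huv⟩ := dif_pos rfl
  have hr_ne (x : V) (hx : x ≠ v) : r x = ⟨x, hx⟩ := dif_neg hx
  rw [← hr_ne a ha, ← hr_ne b hb]
  refine h.of_forall_adj r fun x y hxy ↦ ?_
  by_cases hx : x = v
  · subst hx
    rw [hr_self, hr_ne y hxy.ne']
    exact hdom y hxy
  by_cases hy : y = v
  · subst hy
    rw [hr_self, hr_ne x hx]
    exact (hdom x hxy.symm).symm
  · rw [hr_ne x hx, hr_ne y hy]
    exact SimpleGraph.Adj.reachable (SimpleGraph.induce_adj.2 hxy)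
end
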